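/- Suppose the semidefinite system (P_SD) is in bad normal form. Then the SDP sup{−x_m : x feasible in (P_SD)} has optimal value 0, and there is no symmetric positive semidefinite matrix Y with A_i•Y = 0 for i = 1,…,m−1, A_m•Y = −1, and B•Y = 0. In particular, (P_SD) is badly behaved. -/

import Mathlib

open Matrix

/-- Trace inner product `S • T = trace(ST)` of square real matrices. -/
noncomputable def ip {k : ℕ} (S T : Matrix (Fin k) (Fin k) ℝ) : ℝ :=
  Matrix.trace (S * T)

/-- `x` is feasible for the semidefinite system `∑ xᵢ Aᵢ ⪯ B`. -/
def IsFeasible {n m : ℕ} (A : Fin m → Matrix (Fin n) (Fin n) ℝ)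
    (B : Matrix (Fin n) (Fin n) ℝ) (x : Fin m → ℝ) : Prop :=
  (B - ∑ i, x i • A i).PosSemidef

/-- The set of primal objective values `∑ cᵢ xᵢ` over feasible `x`. -/
def PrimalVals {n m : ℕ} (A : Fin m → Matrix (Fin n) (Fin n) ℝ)
    (B : Matrix (Fin n) (Fin n) ℝ) (c : Fin m → ℝ) : Set ℝ :=
  {s | ∃ x : Fin m → ℝ, IsFeasible A B x ∧ s = ∑ i, c i * x i}

/-- The system `∑ xᵢ Aᵢ ⪯ B` is badly behaved: for some `c` the primal optimal
value is finite (i.e. is a least upper bound `v`), but no dual feasible `Y`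
achieves value `v`. -/
def BadlyBehaved {n m : ℕ} (A : Fin m → Matrix (Fin n) (Fin n) ℝ)
    (B : Matrix (Fin n) (Fin n) ℝ) : Prop :=
  ∃ (c : Fin m → ℝ) (v : ℝ), IsLUB (PrimalVals A B c) v ∧
    ¬ ∃ Y : Matrix (Fin n) (Fin n) ℝ,
        Y.PosSemidef ∧ (∀ i, ip (A i) Y = c i) ∧ ip B Y = v

/-- `Zmat n r = diag(I_r, 0)`. -/
def Zmat (n r : ℕ) : Matrix (Fin n) (Fin n) ℝ :=
  Matrix.of fun i j => if i = j ∧ (i : ℕ) < r then (1 : ℝ) else 0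

/-- `Zmat n r` is a maximum rank slack of `∑ xᵢ Aᵢ ⪯ B`:
it is a slack and every slack has rank at most `r`. -/
def MaxRankSlack {n m : ℕ} (A : Fin m → Matrix (Fin n) (Fin n) ℝ)
    (B : Matrix (Fin n) (Fin n) ℝ) (r : ℕ) : Prop :=
  (∃ x : Fin m → ℝ, B - ∑ i, x i • A i = Zmat n r) ∧
  ∀ x : Fin m → ℝ, IsFeasible A B x → (B - ∑ i, x i • A i).rank ≤ r

/-- Lower-right `(n-r) × (n-r)` block. -/
def block22 {n : ℕ} (r : ℕ) (h : r ≤ n) (V : Matrix (Fin n) (Fin n) ℝ) :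
    Matrix (Fin (n - r)) (Fin (n - r)) ℝ :=
  Matrix.of fun i j => V ⟨r + i.1, by omega⟩ ⟨r + j.1, by omega⟩

/-- Upper-right `r × (n-r)` block. -/
def block12 {n : ℕ} (r : ℕ) (h : r ≤ n) (V : Matrix (Fin n) (Fin n) ℝ) :
    Matrix (Fin r) (Fin (n - r)) ℝ :=
  Matrix.of fun i j => V ⟨i.1, by omega⟩ ⟨r + j.1, by omega⟩

/-- The column space (range space) of a matrix. -/
def colSpace {p q : ℕ} (M : Matrix (Fin p) (Fin q) ℝ) : Submodule ℝ (Fin p → ℝ) :=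
  LinearMap.range M.mulVecLin

/-- The "Bad condition": some linear combination `V` of the `Aᵢ` has `V₂₂ ⪰ 0`
and `ℛ(V₁₂ᵀ) ⊄ ℛ(V₂₂)`. -/
def BadCond {n m : ℕ} (A : Fin m → Matrix (Fin n) (Fin n) ℝ) (r : ℕ) (h : r ≤ n) : Prop :=
  ∃ lam : Fin m → ℝ,
    (block22 r h (∑ i, lam i • A i)).PosSemidef ∧
    ¬ colSpace (block12 r h (∑ i, lam i • A i))ᵀ ≤
        colSpace (block22 r h (∑ i, lam i • A i))

/-- `padLow r h U = diag(0, U)` as an `n × n` matrix. -/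
def padLow {n : ℕ} (r : ℕ) (h : r ≤ n) (U : Matrix (Fin (n - r)) (Fin (n - r)) ℝ) :
    Matrix (Fin n) (Fin n) ℝ :=
  Matrix.of fun a b =>
    if hab : r ≤ (a : ℕ) ∧ r ≤ (b : ℕ) then U ⟨a.1 - r, by omega⟩ ⟨b.1 - r, by omega⟩
    else 0

/-- "Good condition 1": some positive definite `U` has `Aᵢ • diag(0, U) = 0` for all `i`. -/
def GoodCond1 {n m : ℕ} (A : Fin m → Matrix (Fin n) (Fin n) ℝ) (r : ℕ) (h : r ≤ n) : Prop :=
  ∃ U : Matrix (Fin (n - r)) (Fin (n - r)) ℝ, U.PosDef ∧ ∀ i, ip (A i) (padLow r h U) = 0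

/-- "Good condition 2": every linear combination of the `Aᵢ` with zero lower-right
block has zero upper-right block. -/
def GoodCond2 {n m : ℕ} (A : Fin m → Matrix (Fin n) (Fin n) ℝ) (r : ℕ) (h : r ≤ n) : Prop :=
  ∀ lam : Fin m → ℝ, block22 r h (∑ i, lam i • A i) = 0 →
    block12 r h (∑ i, lam i • A i) = 0

/-- `Tmat r h N = [[I_r, 0], [0, N]]`. -/
def Tmat {n : ℕ} (r : ℕ) (h : r ≤ n) (N : Matrix (Fin (n - r)) (Fin (n - r)) ℝ) :
    Matrix (Fin n) (Fin n) ℝ :=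
  Matrix.of fun a b =>
    if (a : ℕ) < r ∧ (b : ℕ) < r then (if a = b then (1 : ℝ) else 0)
    else if hab : r ≤ (a : ℕ) ∧ r ≤ (b : ℕ) then N ⟨a.1 - r, by omega⟩ ⟨b.1 - r, by omega⟩
    else 0

/-- The system `∑ xᵢ A'ᵢ ⪯ B'` is an elementary reformulation of `∑ xᵢ Aᵢ ⪯ B`:
there are an invertible `M : ℝ^{m×m}`, a vector `μ ∈ ℝ^m` and an invertible
`T = [[I_r, 0], [0, N]]` with `A'ᵢ = Tᵀ (∑ⱼ Mᵢⱼ Aⱼ) T` and `B' = Tᵀ (B + ∑ⱼ μⱼ Aⱼ) T`. -/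
def ElemReform {n m : ℕ} (r : ℕ) (h : r ≤ n)
    (A : Fin m → Matrix (Fin n) (Fin n) ℝ) (B : Matrix (Fin n) (Fin n) ℝ)
    (A' : Fin m → Matrix (Fin n) (Fin n) ℝ) (B' : Matrix (Fin n) (Fin n) ℝ) : Prop :=
  ∃ (M : Matrix (Fin m) (Fin m) ℝ) (μ : Fin m → ℝ)
    (N : Matrix (Fin (n - r)) (Fin (n - r)) ℝ),
    IsUnit M ∧ IsUnit (Tmat r h N) ∧
    (∀ i, A' i = (Tmat r h N)ᵀ * (∑ j, M i j • A j) * Tmat r h N) ∧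
    B' = (Tmat r h N)ᵀ * (B + ∑ j, μ j • A j) * Tmat r h N

/-- The last `n - r` columns of a square matrix, as an `n × (n-r)` matrix. -/
def lastCols {n : ℕ} (r : ℕ) (h : r ≤ n) (V : Matrix (Fin n) (Fin n) ℝ) :
    Matrix (Fin n) (Fin (n - r)) ℝ :=
  Matrix.of fun a j => V a ⟨r + j.1, by omega⟩

/-- Bad normal form of a semidefinite system. -/
def BadNormalForm {n m : ℕ} (A : Fin m → Matrix (Fin n) (Fin n) ℝ)
    (B : Matrix (Fin n) (Fin n) ℝ) (r : ℕ) (h : r ≤ n) : Prop :=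
  B = Zmat n r ∧ MaxRankSlack A B r ∧
  ∃ k : ℕ, ∃ hk : k < m,
    (∀ i : Fin m, (i : ℕ) < k → ∀ a b : Fin n, r ≤ (b : ℕ) → A i a b = 0) ∧
    (∀ i : Fin m, (i : ℕ) < k → ∀ a b : Fin n, r ≤ (a : ℕ) → A i a b = 0) ∧
    LinearIndependent ℝ (fun i : Fin (m - k) => lastCols r h (A ⟨k + i.1, by omega⟩)) ∧
    (block22 r h (A ⟨m - 1, by omega⟩)).PosSemidef

/-- Good normal form of a semidefinite system. -/
def GoodNormalForm {n m : ℕ} (A : Fin m → Matrix (Fin n) (Fin n) ℝ)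
    (B : Matrix (Fin n) (Fin n) ℝ) (r : ℕ) (h : r ≤ n) : Prop :=
  B = Zmat n r ∧ MaxRankSlack A B r ∧
  ∃ k : ℕ, ∃ _hk : k ≤ m,
    (∀ i : Fin m, (i : ℕ) < k → ∀ a b : Fin n,
        (r ≤ (a : ℕ) ∨ r ≤ (b : ℕ)) → A i a b = 0) ∧
    LinearIndependent ℝ (fun i : Fin (m - k) => block22 r h (A ⟨k + i.1, by omega⟩)) ∧
    ∃ U : Matrix (Fin (n - r)) (Fin (n - r)) ℝ, U.PosDef ∧
      ∀ i : Fin m, k ≤ (i : ℕ) → ip (block22 r h (A i)) U = 0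

/-- The image of the positive semidefinite cone under `Y ↦ (A₁ • Y, …, A_m • Y)`. -/
def imageSet {n m : ℕ} (A : Fin m → Matrix (Fin n) (Fin n) ℝ) : Set (Fin m → ℝ) :=
  {y | ∃ Y : Matrix (Fin n) (Fin n) ℝ, Y.PosSemidef ∧ ∀ i, ip (A i) Y = y i}

namespace Matrix

/-- A principal diagonal zero of a positive semidefinite matrix forces its column to vanish. -/
theorem PosSemidef.col_eq_zero_of_diag_eq_zero {ι : Type*} [Fintype ι] [DecidableEq ι]
    {Y : Matrix ι ι ℝ} (hY : Y.PosSemidef) {j : ι} (hj : Y j j = 0) (i : ι) : Y i j = 0 := by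
  have h := (hY.dotProduct_mulVec_zero_iff (Pi.single j 1)).1 (by simp [hj])
  simpa using congrFun h i

theorem PosSemidef.trace_mul_nonneg {ι : Type*} [Fintype ι] [DecidableEq ι]
    {S T : Matrix ι ι ℝ} (hS : S.PosSemidef) (hT : T.PosSemidef) : 0 ≤ (S * T).trace := by
  obtain ⟨C, rfl⟩ : ∃ C : Matrix ι ι ℝ, T = Cᴴ * C := by
    open scoped MatrixOrder in
    exact CStarAlgebra.nonneg_iff_eq_star_mul_self.mp hT.nonneg
  rw [← Matrix.mul_assoc, trace_mul_comm, ← Matrix.mul_assoc]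
  exact (hS.mul_mul_conjTranspose_same C).trace_nonneg

theorem PosSemidef.mulVec_eq_zero_of_add {ι : Type*} [Fintype ι] [DecidableEq ι]
    {S T : Matrix ι ι ℝ} (hS : S.PosSemidef) (hT : T.PosSemidef) {v : ι → ℝ}
    (hv : (S + T) *ᵥ v = 0) : T *ᵥ v = 0 := by
  have h : star v ⬝ᵥ (S *ᵥ v) + star v ⬝ᵥ (T *ᵥ v) = 0 := by
    rw [← dotProduct_add, ← add_mulVec, hv, dotProduct_zero]
  refine (hT.dotProduct_mulVec_zero_iff v).1 ?_
  linarith [hS.dotProduct_mulVec_nonneg v, hT.dotProduct_mulVec_nonneg v]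

/-- If adding a positive semidefinite `S` to `T` does not increase the rank, then the kernel
of `T` is contained in the kernel of `S`. -/
theorem PosSemidef.mulVec_eq_zero_of_rank_add_le {ι : Type*} [Fintype ι] [DecidableEq ι]
    {S T : Matrix ι ι ℝ} (hS : S.PosSemidef) (hT : T.PosSemidef)
    (hrank : (S + T).rank ≤ T.rank) {v : ι → ℝ} (hv : T *ᵥ v = 0) : S *ᵥ v = 0 := by
  have hle : LinearMap.ker (S + T).mulVecLin ≤ LinearMap.ker T.mulVecLin := fun w hw => by
    simp only [LinearMap.mem_ker, mulVecLin_apply] at hw ⊢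
    exact hS.mulVec_eq_zero_of_add hT hw
  have hST := (S + T).mulVecLin.finrank_range_add_finrank_ker
  have hT' := T.mulVecLin.finrank_range_add_finrank_ker
  have heq : LinearMap.ker (S + T).mulVecLin = LinearMap.ker T.mulVecLin :=
    Submodule.eq_of_le_of_finrank_le hle (by unfold Matrix.rank at hrank; omega)
  have hmem : v ∈ LinearMap.ker (S + T).mulVecLin := by
    rw [heq]
    simpa using hv
  have h : (S + T) *ᵥ v = 0 := by
    simpa only [LinearMap.mem_ker, mulVecLin_apply] using hmem
  rw [add_comm] at h
  exact hT.mulVec_eq_zero_of_add hS h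

/-- If `Y` is supported on the range of an injection `f`, the trace of `S * Y` only
sees the principal submatrices along `f`. -/
theorem trace_mul_eq_trace_submatrix {ι κ : Type*} [Fintype ι] [Fintype κ] {f : κ → ι}
    (hf : Function.Injective f) (S Y : Matrix ι ι ℝ)
    (hrow : ∀ i ∉ Set.range f, ∀ j, Y i j = 0) (hcol : ∀ j ∉ Set.range f, ∀ i, Y i j = 0) :
    (S * Y).trace = (S.submatrix f f * Y.submatrix f f).trace := by
  simp only [trace, diag_apply, mul_apply, submatrix_apply]
  refine (Fintype.sum_of_injective f hf _ _ (fun i hi => ?_) fun i => ?_).symm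
  · exact Finset.sum_eq_zero fun j _ => by rw [hcol i hi j, mul_zero]
  · exact Fintype.sum_of_injective f hf _ _ (fun j hj => by rw [hrow j hj, mul_zero])
      fun _ => rfl

end Matrix

theorem Zmat_eq_diagonal (n r : ℕ) :
    Zmat n r = diagonal fun i : Fin n => if (i : ℕ) < r then (1 : ℝ) else 0 := by
  ext i j
  simp only [Zmat, of_apply, diagonal_apply, ite_and]

theorem posSemidef_Zmat (n r : ℕ) : (Zmat n r).PosSemidef := by
  rw [Zmat_eq_diagonal, posSemidef_diagonal_iff]
  intro i
  split_ifs <;> norm_num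

theorem rank_Zmat {n r : ℕ} (h : r ≤ n) : (Zmat n r).rank = r := by
  rw [Zmat_eq_diagonal, rank_diagonal]
  simp [Fintype.card_subtype, Fin.card_filter_val_lt, h]

theorem Zmat_mulVec_single {n r : ℕ} {j : Fin n} (hj : r ≤ (j : ℕ)) :
    Zmat n r *ᵥ Pi.single j 1 = 0 := by
  ext i
  by_cases hij : i = j
  · subst hij
    simp [Zmat, hj]
  · simp [Zmat, hij]

theorem ip_Zmat {n : ℕ} (r : ℕ) (Y : Matrix (Fin n) (Fin n) ℝ) :
    ip (Zmat n r) Y = ∑ i : Fin n, if (i : ℕ) < r then Y i i else 0 := by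
  simp [ip, Zmat_eq_diagonal, trace, diagonal_mul]

/-- In a system whose right-hand side is a maximum rank slack `diag(I_r, 0)`, every slack has
zero last columns. -/
theorem MaxRankSlack.slack_apply_eq_zero {n m : ℕ} {A : Fin m → Matrix (Fin n) (Fin n) ℝ}
    {r : ℕ} (hr : r ≤ n) (hmax : MaxRankSlack A (Zmat n r) r) {x : Fin m → ℝ}
    (hx : IsFeasible A (Zmat n r) x) (i : Fin n) {j : Fin n} (hj : r ≤ (j : ℕ)) :
    (Zmat n r - ∑ l, x l • A l) i j = 0 := by
  set S := Zmat n r - ∑ l, x l • A l with hS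
  have hmid : Zmat n r - ∑ l, ((1 / 2 : ℝ) • x) l • A l = (1 / 2 : ℝ) • (S + Zmat n r) := by
    have : ∑ l, ((1 / 2 : ℝ) • x) l • A l = (1 / 2 : ℝ) • ∑ l, x l • A l := by
      simp [Finset.smul_sum, smul_smul]
    rw [this, hS]
    module
  have hrank := hmax.2 ((1 / 2 : ℝ) • x) (by
    rw [IsFeasible, hmid]
    exact (PosSemidef.add hx (posSemidef_Zmat n r)).smul (by norm_num))
  rw [hmid, rank_smul_of_mem_nonZeroDivisors _ (mem_nonZeroDivisors_of_ne_zero (by norm_num))] at hrank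
  have h := PosSemidef.mulVec_eq_zero_of_rank_add_le hx (posSemidef_Zmat n r)
    (by rwa [rank_Zmat hr]) (Zmat_mulVec_single hj)
  rw [mulVec_single_one] at h
  exact congrFun h i

theorem BadNormalForm.eq_zero_of_isFeasible {n m : ℕ}
    {A : Fin m → Matrix (Fin n) (Fin n) ℝ} {B : Matrix (Fin n) (Fin n) ℝ} {r : ℕ} {hr : r ≤ n}
    (hbnf : BadNormalForm A B r hr) {x : Fin m → ℝ} (hx : IsFeasible A B x) (i : Fin m)
    (hi : (i : ℕ) = m - 1) : x i = 0 := by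
  obtain ⟨rfl, hmax, k, hk, hzero, -, hli, -⟩ := hbnf
  obtain ⟨d, rfl⟩ : ∃ d, m = k + d := ⟨m - k, by omega⟩
  rw [Fintype.linearIndependent_iff] at hli
  have h := hli (fun l => x ⟨k + l, by omega⟩) (by
    ext a j
    have hS := hmax.slack_apply_eq_zero hr hx a (j := ⟨r + j, by omega⟩) (by simp)
    have hZ : Zmat n r a ⟨r + j, by omega⟩ = 0 := by
      simp [Zmat, Fin.ext_iff]
      omega
    rw [Matrix.sub_apply, hZ, zero_sub, neg_eq_zero, Matrix.sum_apply, Fin.sum_univ_add,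
      Finset.sum_eq_zero, zero_add] at hS
    · rw [Matrix.sum_apply, Matrix.zero_apply, ← hS]
      refine Fintype.sum_equiv (finCongr (by omega)) _ _ fun l => ?_
      simp only [lastCols, Matrix.smul_apply, of_apply]
      rfl
    · intro l _
      rw [Matrix.smul_apply, hzero _ (by simp) _ _ (by simp), smul_zero])
  have hlast := h ⟨k + d - 1 - k, by omega⟩
  rw [← hlast]
  congr 1
  ext
  simp only
  omega

theorem BadNormalForm.ip_nonneg {n m : ℕ}
    {A : Fin m → Matrix (Fin n) (Fin n) ℝ} {B : Matrix (Fin n) (Fin n) ℝ} {r : ℕ} {hr : r ≤ n}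
    (hbnf : BadNormalForm A B r hr) {Y : Matrix (Fin n) (Fin n) ℝ} (hY : Y.PosSemidef)
    (hBY : ip B Y = 0) (i : Fin m) (hi : (i : ℕ) = m - 1) : 0 ≤ ip (A i) Y := by
  obtain ⟨rfl, -, k, hk, -, -, -, hpsd⟩ := hbnf
  rw [show (⟨m - 1, by omega⟩ : Fin m) = i from Fin.ext hi.symm] at hpsd
  rw [ip_Zmat, Finset.sum_eq_zero_iff_of_nonneg fun i _ => by
    split_ifs <;> simp [hY.diag_nonneg]] at hBY
  let f : Fin (n - r) → Fin n := fun j => ⟨r + j, by omega⟩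
  have hf : Function.Injective f := fun a b hab => by
    simpa [f, Fin.ext_iff] using hab
  have hlt : ∀ j ∉ Set.range f, (j : ℕ) < r := fun j hj => by
    by_contra hjr
    exact hj ⟨⟨j - r, by omega⟩, Fin.ext (by simp only [f]; omega)⟩
  have hcol : ∀ j ∉ Set.range f, ∀ i, Y i j = 0 := fun j hj =>
    hY.col_eq_zero_of_diag_eq_zero (by simpa [hlt j hj] using hBY j (Finset.mem_univ j))
  have hrow : ∀ i ∉ Set.range f, ∀ j, Y i j = 0 := fun i hi j => by
    rw [← hY.isHermitian.apply i j, hcol i hi j, star_zero]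
  rw [ip, trace_mul_eq_trace_submatrix hf _ _ hrow hcol]
  exact PosSemidef.trace_mul_nonneg hpsd (hY.submatrix f)

/-- If the system is in bad normal form, then the SDP
`sup { -x_m : x feasible }` has optimal value `0`, no psd `Y` satisfies
`Aᵢ • Y = 0 (i < m)`, `A_m • Y = -1` and `B • Y = 0`; in particular the system
is badly behaved. -/
theorem stmt6 {n m : ℕ} (hn : 0 < n) (hm : 0 < m)
    (A : Fin m → Matrix (Fin n) (Fin n) ℝ) (B : Matrix (Fin n) (Fin n) ℝ)
    (hA : ∀ i, (A i).IsSymm)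
    (r : ℕ) (hr : r ≤ n) (hbnf : BadNormalForm A B r hr) :
    IsLUB (PrimalVals A B (fun i => if (i : ℕ) = m - 1 then (-1 : ℝ) else 0)) 0 ∧
    (¬ ∃ Y : Matrix (Fin n) (Fin n) ℝ, Y.PosSemidef ∧
        (∀ i : Fin m, ip (A i) Y = if (i : ℕ) = m - 1 then (-1 : ℝ) else 0) ∧
        ip B Y = 0) ∧
    BadlyBehaved A B := by
  have hlub : IsLUB (PrimalVals A B (fun i => if (i : ℕ) = m - 1 then (-1 : ℝ) else 0)) 0 := by
    suffices h : PrimalVals A B (fun i => if (i : ℕ) = m - 1 then (-1 : ℝ) else 0) = {0} by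
      rw [h]
      exact isLUB_singleton
    ext s
    rw [Set.mem_singleton_iff]
    constructor
    · rintro ⟨x, hx, rfl⟩
      refine Finset.sum_eq_zero fun i _ => ?_
      beta_reduce
      split_ifs with hi
      · rw [hbnf.eq_zero_of_isFeasible hx i hi, mul_zero]
      · exact zero_mul _
    · rintro rfl
      refine ⟨0, ?_, by simp⟩
      simpa [IsFeasible, hbnf.1] using posSemidef_Zmat n r
  have hdual : ¬ ∃ Y : Matrix (Fin n) (Fin n) ℝ, Y.PosSemidef ∧
      (∀ i : Fin m, ip (A i) Y = if (i : ℕ) = m - 1 then (-1 : ℝ) else 0) ∧ ip B Y = 0 := by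
    rintro ⟨Y, hY, hAY, hBY⟩
    have h := hbnf.ip_nonneg hY hBY ⟨m - 1, by omega⟩ rfl
    rw [hAY, if_pos rfl] at h
    linarith
  exact ⟨hlub, hdual, _, 0, hlub, hdual⟩
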